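/- Define g₄(x) = log₂(e)·arctan(x) − (1/x)·log₂(1+x²) for x > 0. Then g₄ is monotonically increasing on (0, ∞) and g₄(x) ≥ 0 for all x > 0 (using lim_{x→0⁺} log₂(1+x²)/x = 0). -/

import Mathlib

open Real

noncomputable def g₄ (x : ℝ) : ℝ :=
  Real.logb 2 (Real.exp 1) * Real.arctan x - (1/x) * Real.logb 2 (1 + x^2)

lemma g₄_eq (x : ℝ) : g₄ x = (arctan x - log (1 + x ^ 2) / x) / log 2 := by
  simp only [g₄, Real.logb, Real.log_exp]
  ring

lemma hasDerivAt_arctan_sub_log_div {x : ℝ} (hx : x ≠ 0) :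
    HasDerivAt (fun y : ℝ => arctan y - log (1 + y ^ 2) / y)
      ((log (1 + x ^ 2) - x ^ 2 / (1 + x ^ 2)) / x ^ 2) x := by
  have h0 : 1 + x ^ 2 ≠ 0 := by positivity
  have h1 : HasDerivAt (fun y : ℝ => 1 + y ^ 2) (2 * x) x := by
    simpa using (hasDerivAt_pow 2 x).const_add 1
  refine ((hasDerivAt_arctan x).sub ((h1.log h0).div (hasDerivAt_id x) hx)).congr_deriv ?_
  simp only [id]
  field_simp
  ring

lemma div_one_add_lt_log_one_add {u : ℝ} (hu : 0 < u) : u / (1 + u) < log (1 + u) := by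
  have h := log_lt_sub_one_of_pos (x := (1 + u)⁻¹) (by positivity)
    (by rw [Ne, inv_eq_one]; linarith)
  rw [log_inv] at h
  have h2 : u / (1 + u) = 1 - (1 + u)⁻¹ := by field_simp; ring
  linarith

lemma strictMonoOn_arctan_sub_log_div :
    StrictMonoOn (fun y : ℝ => arctan y - log (1 + y ^ 2) / y) (Set.Ioi 0) := by
  refine strictMonoOn_of_deriv_pos (convex_Ioi 0)
    (fun x hx => (hasDerivAt_arctan_sub_log_div
      (ne_of_gt hx)).continuousAt.continuousWithinAt) fun x hx => ?_
  rw [interior_Ioi] at hx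
  have hx : 0 < x := hx
  rw [(hasDerivAt_arctan_sub_log_div hx.ne').deriv]
  have := div_one_add_lt_log_one_add (u := x ^ 2) (by positivity)
  exact div_pos (by linarith) (by positivity)

lemma neg_le_arctan_sub_log_div {y : ℝ} (hy : 0 < y) :
    -y ≤ arctan y - log (1 + y ^ 2) / y := by
  have h1 : log (1 + y ^ 2) / y ≤ y := by
    rw [div_le_iff₀ hy]
    have := log_le_sub_one_of_pos (x := 1 + y ^ 2) (by positivity)
    linarith
  have h2 : 0 ≤ arctan y := arctan_nonneg.2 hy.le
  linarith

lemma arctan_sub_log_div_nonneg {x : ℝ} (hx : 0 < x) :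
    0 ≤ arctan x - log (1 + x ^ 2) / x := by
  refine le_of_forall_pos_le_add fun ε hε => ?_
  have hy : 0 < min x ε := lt_min hx hε
  have h1 := strictMonoOn_arctan_sub_log_div.monotoneOn hy hx (min_le_left x ε)
  have h2 := neg_le_arctan_sub_log_div hy
  have h3 := min_le_right x ε
  linarith

theorem stmt_5 :
    StrictMonoOn g₄ (Set.Ioi (0:ℝ)) ∧ (∀ x : ℝ, 0 < x → 0 ≤ g₄ x) := by
  have h2 : 0 < log 2 := log_pos one_lt_two
  refine ⟨fun x hx y hy hxy => ?_, fun x hx => ?_⟩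
  · rw [g₄_eq, g₄_eq]
    exact div_lt_div_of_pos_right (strictMonoOn_arctan_sub_log_div hx hy hxy) h2
  · rw [g₄_eq]
    exact div_nonneg (arctan_sub_log_div_nonneg hx) h2.le
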